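/- arXiv:2404.02514 — 6 statements merged into one kernel-verified Lean document; each statement's English description precedes it below -/
import Mathlib

section
/- Let S be an N×N real matrix with nonnegative entries that is doubly stochastic (every row sums to 1 and every column sums to 1), and let v ∈ ℝ^N. Then ‖v‖² − ‖Sv‖² = (1/2) · Σ_{i=1}^{N} Σ_{j=1}^{N} Σ_{k=1}^{N} S_{ij} S_{ik} (v_j − v_k)². -/
open Matrix

/-- Twice the variance of `v` under weights `w` of total mass one is the weighted mean of the
squared pairwise differences. -/
theorem sum_sum_mul_sub_sq {ι : Type*} [Fintype ι] (w v : ι → ℝ) (hw : ∑ j, w j = 1) :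
    ∑ j, ∑ k, w j * w k * (v j - v k) ^ 2
      = 2 * (∑ j, w j * v j ^ 2 - (∑ j, w j * v j) ^ 2) := by
  have expand (j k : ι) : w j * w k * (v j - v k) ^ 2
      = w j * v j ^ 2 * w k + w j * (w k * v k ^ 2) - 2 * (w j * v j * (w k * v k)) := by ring
  simp_rw [expand, Finset.sum_sub_distrib, Finset.sum_add_distrib, ← Finset.mul_sum,
    ← Finset.sum_mul, hw]
  ring

/-- For a doubly stochastic matrix `S` with nonnegative entries and a vector `v`,
`‖v‖² − ‖Sv‖² = (1/2) Σᵢⱼₖ Sᵢⱼ Sᵢₖ (vⱼ − vₖ)²` (Euclidean norm). -/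
theorem stmt_0 {N : ℕ} (S : Matrix (Fin N) (Fin N) ℝ)
    (hS : ∀ i j, 0 ≤ S i j)
    (hrow : ∀ i, ∑ j, S i j = 1)
    (hcol : ∀ j, ∑ i, S i j = 1)
    (v : Fin N → ℝ) :
    ‖(WithLp.equiv 2 (Fin N → ℝ)).symm v‖ ^ 2
      - ‖(WithLp.equiv 2 (Fin N → ℝ)).symm (S.mulVec v)‖ ^ 2
      = (1 / 2) * ∑ i, ∑ j, ∑ k, S i j * S i k * (v j - v k) ^ 2 := by
  have hv : ∑ i, ∑ j, S i j * v j ^ 2 = ∑ j, v j ^ 2 := by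
    rw [Finset.sum_comm]
    simp_rw [← Finset.sum_mul, hcol, one_mul]
  simp_rw [sum_sum_mul_sub_sq (S _) v (hrow _), ← Finset.mul_sum, Finset.sum_sub_distrib, hv,
    EuclideanSpace.real_norm_sq_eq]
  simp [Matrix.mulVec, dotProduct]
end

section
/- Let S be an N×N real matrix with nonnegative entries that is doubly stochastic (every row sums to 1 and every column sums to 1), and let v ∈ ℝ^N. If there exist indices i, j, k such that S_{ij} > 0, S_{ik} > 0 and v_j ≠ v_k, then ‖Sv‖² < ‖v‖² strictly. -/
open Matrix

/-- The variance identity for finitely supported weights of total mass one. -/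
theorem sum_mul_sub_mean_sq {ι : Type*} [Fintype ι] (w v : ι → ℝ) (hw : ∑ j, w j = 1) :
    ∑ j, w j * (v j - w ⬝ᵥ v) ^ 2 = ∑ j, w j * v j ^ 2 - (w ⬝ᵥ v) ^ 2 := by
  have expand (m : ℝ) : ∑ j, w j * (v j - m) ^ 2 =
      ∑ j, w j * v j ^ 2 - 2 * m * (w ⬝ᵥ v) + m ^ 2 * ∑ j, w j := by
    simp only [dotProduct, Finset.mul_sum, ← Finset.sum_sub_distrib, ← Finset.sum_add_distrib]
    exact Finset.sum_congr rfl fun j _ => by ring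
  rw [expand, hw]
  ring

/-- Jensen's inequality for the square. -/
theorem dotProduct_sq_le {ι : Type*} [Fintype ι] (w v : ι → ℝ) (hw₀ : ∀ j, 0 ≤ w j)
    (hw : ∑ j, w j = 1) : (w ⬝ᵥ v) ^ 2 ≤ ∑ j, w j * v j ^ 2 := by
  rw [← sub_nonneg, ← sum_mul_sub_mean_sq w v hw]
  exact Finset.sum_nonneg fun j _ => mul_nonneg (hw₀ j) (sq_nonneg _)

/-- Jensen's inequality for the square is strict if the values differ on the support. -/
theorem dotProduct_sq_lt {ι : Type*} [Fintype ι] (w v : ι → ℝ) (hw₀ : ∀ j, 0 ≤ w j)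
    (hw : ∑ j, w j = 1) {j k : ι} (hj : 0 < w j) (hk : 0 < w k) (hjk : v j ≠ v k) :
    (w ⬝ᵥ v) ^ 2 < ∑ j, w j * v j ^ 2 := by
  rw [← sub_pos, ← sum_mul_sub_mean_sq w v hw]
  obtain ⟨l, hl, hne⟩ : ∃ l, 0 < w l ∧ v l ≠ w ⬝ᵥ v := by
    by_contra! hc
    exact hjk ((hc j hj).trans (hc k hk).symm)
  exact Finset.sum_pos' (fun l _ => mul_nonneg (hw₀ l) (sq_nonneg _))
    ⟨l, Finset.mem_univ l, mul_pos hl (sq_pos_of_ne_zero (sub_ne_zero.mpr hne))⟩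

/-- For a doubly stochastic matrix `S` with nonnegative entries, if some row `i`
has positive entries at two columns `j`, `k` where `v` differs, then
`‖Sv‖² < ‖v‖²` strictly (Euclidean norm). -/
theorem stmt_2 {N : ℕ} (S : Matrix (Fin N) (Fin N) ℝ)
    (hS : ∀ i j, 0 ≤ S i j)
    (hrow : ∀ i, ∑ j, S i j = 1)
    (hcol : ∀ j, ∑ i, S i j = 1)
    (v : Fin N → ℝ)
    (h : ∃ i j k, 0 < S i j ∧ 0 < S i k ∧ v j ≠ v k) :
    ‖(WithLp.equiv 2 (Fin N → ℝ)).symm (S.mulVec v)‖ ^ 2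
      < ‖(WithLp.equiv 2 (Fin N → ℝ)).symm v‖ ^ 2 := by
  obtain ⟨i, j, k, hj, hk, hjk⟩ := h
  simp only [EuclideanSpace.real_norm_sq_eq, WithLp.equiv_symm_apply]
  calc ∑ i, (S.mulVec v) i ^ 2
      < ∑ i, ∑ j, S i j * v j ^ 2 :=
        Finset.sum_lt_sum (fun i _ => dotProduct_sq_le (S i) v (hS i) (hrow i))
          ⟨i, Finset.mem_univ i, dotProduct_sq_lt (S i) v (hS i) (hrow i) hj hk hjk⟩
    _ = ∑ j, v j ^ 2 := by
        rw [Finset.sum_comm]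
        simp only [← Finset.sum_mul, hcol, one_mul]
end

section
/- Let P and Q be N×N real symmetric idempotent matrices (orthogonal projections), let S be an N×N real doubly stochastic matrix with nonnegative entries, and let v ∈ ℝ^N satisfy Pv = 0. If there exist indices i, j, k with S_{ij} > 0, S_{ik} > 0 and v_j ≠ v_k, then ‖(I − Q)(Sv)‖ < ‖(I − P)v‖. -/
open Matrix

/-- The complement of an orthogonal projection does not increase the sum of squares. -/
lemma dotProduct_one_sub_mulVec_self_le {ι : Type*} [Fintype ι] [DecidableEq ι]
    {Q : Matrix ι ι ℝ} (hsym : Qᵀ = Q) (hidem : Q * Q = Q) (w : ι → ℝ) :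
    (1 - Q) *ᵥ w ⬝ᵥ (1 - Q) *ᵥ w ≤ w ⬝ᵥ w := by
  have hQ : Q *ᵥ w ⬝ᵥ Q *ᵥ w = w ⬝ᵥ Q *ᵥ w := by
    rw [dotProduct_mulVec, ← mulVec_transpose, hsym, mulVec_mulVec, hidem, dotProduct_comm]
  have hnonneg : 0 ≤ Q *ᵥ w ⬝ᵥ Q *ᵥ w := Finset.sum_nonneg fun i _ => mul_self_nonneg _
  rw [sub_mulVec, one_mulVec, sub_dotProduct, dotProduct_sub, dotProduct_sub,
    dotProduct_comm (Q *ᵥ w) w]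
  linarith

/-- The second moment of a weighted family exceeds the square of its mean by its variance. -/
lemma sum_mul_sq_eq_sq_add_sum_mul_sub_sq {ι : Type*} [Fintype ι] {p : ι → ℝ}
    (hsum : ∑ j, p j = 1) (v : ι → ℝ) :
    ∑ j, p j * v j ^ 2 = (p ⬝ᵥ v) ^ 2 + ∑ j, p j * (v j - p ⬝ᵥ v) ^ 2 := by
  set m := p ⬝ᵥ v
  have hexpand : ∑ j, p j * (v j - m) ^ 2
      = ∑ j, p j * v j ^ 2 - 2 * m * ∑ j, p j * v j + m ^ 2 * ∑ j, p j := by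
    rw [Finset.mul_sum, Finset.mul_sum, ← Finset.sum_sub_distrib, ← Finset.sum_add_distrib]
    exact Finset.sum_congr rfl fun j _ => by ring
  have hmean : ∑ j, p j * v j = m := rfl
  rw [hexpand, hmean, hsum]
  ring

/-- A doubly stochastic matrix strictly decreases the sum of squares of a vector that is not
constant on the support of some row. -/
lemma dotProduct_mulVec_self_lt {ι : Type*} [Fintype ι] {S : Matrix ι ι ℝ}
    (hS : ∀ i j, 0 ≤ S i j) (hrow : ∀ i, ∑ j, S i j = 1) (hcol : ∀ j, ∑ i, S i j = 1)
    {v : ι → ℝ} (h : ∃ i j k, 0 < S i j ∧ 0 < S i k ∧ v j ≠ v k) :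
    S *ᵥ v ⬝ᵥ S *ᵥ v < v ⬝ᵥ v := by
  have hswap : v ⬝ᵥ v = ∑ i, ∑ j, S i j * v j ^ 2 := by
    rw [Finset.sum_comm]
    refine Finset.sum_congr rfl fun j _ => ?_
    rw [← Finset.sum_mul, hcol, one_mul, sq]
  have hterm (i j : ι) : 0 ≤ S i j * (v j - S i ⬝ᵥ v) ^ 2 := mul_nonneg (hS i j) (sq_nonneg _)
  have hvar (i : ι) := sum_mul_sq_eq_sq_add_sum_mul_sub_sq (hrow i) v
  have hself (i : ι) : (S *ᵥ v) i * (S *ᵥ v) i = (S i ⬝ᵥ v) ^ 2 := (sq _).symm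
  rw [hswap]
  refine Finset.sum_lt_sum (fun i _ => ?_) ?_
  · rw [hself, hvar]
    exact le_add_of_nonneg_right (Finset.sum_nonneg fun j _ => hterm i j)
  · obtain ⟨i, j, k, hj, hk, hne⟩ := h
    refine ⟨i, Finset.mem_univ i, ?_⟩
    rw [hself, hvar]
    obtain ⟨l, hl, hlne⟩ : ∃ l, 0 < S i l ∧ v l ≠ S i ⬝ᵥ v := by
      by_cases hjm : v j = S i ⬝ᵥ v
      · exact ⟨k, hk, fun hkm => hne (hjm.trans hkm.symm)⟩
      · exact ⟨j, hj, hjm⟩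
    exact lt_add_of_pos_right _ (Finset.sum_pos' (fun j _ => hterm i j)
      ⟨l, Finset.mem_univ l, mul_pos hl (sq_pos_of_ne_zero (sub_ne_zero.mpr hlne))⟩)

/-- For orthogonal projections `P`, `Q`, a doubly stochastic matrix `S` with
nonnegative entries, and a vector `v` with `Pv = 0`: if some row of `S` has two
positive entries where `v` differs, then `‖(I − Q)(Sv)‖ < ‖(I − P)v‖`. -/
theorem stmt_4 {N : ℕ} (P Q S : Matrix (Fin N) (Fin N) ℝ)
    (hPsym : Pᵀ = P) (hPidem : P * P = P)
    (hQsym : Qᵀ = Q) (hQidem : Q * Q = Q)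
    (hS : ∀ i j, 0 ≤ S i j)
    (hrow : ∀ i, ∑ j, S i j = 1)
    (hcol : ∀ j, ∑ i, S i j = 1)
    (v : Fin N → ℝ) (hPv : P.mulVec v = 0)
    (h : ∃ i j k, 0 < S i j ∧ 0 < S i k ∧ v j ≠ v k) :
    ‖(WithLp.equiv 2 (Fin N → ℝ)).symm ((1 - Q).mulVec (S.mulVec v))‖
      < ‖(WithLp.equiv 2 (Fin N → ℝ)).symm ((1 - P).mulVec v)‖ := by
  have hv : (1 - P) *ᵥ v = v := by rw [sub_mulVec, one_mulVec, hPv, sub_zero]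
  have hnorm (x : Fin N → ℝ) :
      ‖(WithLp.equiv 2 (Fin N → ℝ)).symm x‖ = Real.sqrt (x ⬝ᵥ x) := by
    simp [EuclideanSpace.norm_eq, dotProduct, sq]
  rw [hv, hnorm, hnorm]
  exact Real.sqrt_lt_sqrt (Finset.sum_nonneg fun i _ => mul_self_nonneg _)
    ((dotProduct_one_sub_mulVec_self_le hQsym hQidem _).trans_lt
      (dotProduct_mulVec_self_lt hS hrow hcol h))
end

section
/- Let Σ be an m×m symmetric positive definite real matrix, Ū an n×m real matrix, and Ē an n×k real matrix with ĒᵀĒ invertible. Define, for sufficiently small μ > 0, M₂₂(μ) = (μ ĒᵀĒ − μ² Ēᵀ Ū (Σ + μ ŪᵀŪ)⁻¹ Ūᵀ Ē)⁻¹ and M₁₂(μ) = −μ (Σ + μ ŪᵀŪ)⁻¹ Ūᵀ Ē M₂₂(μ). Then M₁₂(μ) converges to −Σ⁻¹ Ūᵀ Ē (ĒᵀĒ)⁻¹ as μ → 0⁺. -/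
open Matrix Filter

/-- Matrix inversion over `ℝ` commutes with limits at an invertible matrix. -/
lemma tendsto_matrix_inv {ι α : Type*} [Fintype ι] [DecidableEq ι] {l : Filter α}
    {f : α → Matrix ι ι ℝ} {A : Matrix ι ι ℝ} (hA : IsUnit A.det)
    (hf : Tendsto f l (nhds A)) : Tendsto (fun x => (f x)⁻¹) l (nhds A⁻¹) := by
  refine (continuousAt_matrix_inv A ?_).tendsto.comp hf
  rw [Ring.inverse_eq_inv']
  exact continuousAt_inv₀ hA.ne_zero

/-- The Schur-complement block
`M₁₂(μ) = −μ (Σ + μŪᵀŪ)⁻¹ ŪᵀĒ M₂₂(μ)`, where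
`M₂₂(μ) = (μ ĒᵀĒ − μ² ĒᵀŪ(Σ + μŪᵀŪ)⁻¹ŪᵀĒ)⁻¹`, converges to
`−Σ⁻¹ ŪᵀĒ (ĒᵀĒ)⁻¹` as `μ → 0⁺`. -/
theorem stmt_6 {n m k : ℕ}
    (Sig : Matrix (Fin m) (Fin m) ℝ) (hSig : Sig.PosDef)
    (U : Matrix (Fin n) (Fin m) ℝ) (E : Matrix (Fin n) (Fin k) ℝ)
    (hE : IsUnit (Eᵀ * E).det) :
    Tendsto
      (fun μ : ℝ =>
        -(μ • ((Sig + μ • (Uᵀ * U))⁻¹ * Uᵀ * E *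
          (μ • (Eᵀ * E)
            - (μ ^ 2) • (Eᵀ * U * (Sig + μ • (Uᵀ * U))⁻¹ * Uᵀ * E))⁻¹)))
      (nhdsWithin 0 (Set.Ioi 0))
      (nhds (-(Sig⁻¹ * Uᵀ * E * (Eᵀ * E)⁻¹))) := by
  have hR : Tendsto (fun μ : ℝ => (Sig + μ • (Uᵀ * U))⁻¹) (nhdsWithin 0 (Set.Ioi 0))
      (nhds Sig⁻¹) := by
    refine tendsto_matrix_inv hSig.det_pos.ne'.isUnit (tendsto_nhdsWithin_of_tendsto_nhds ?_)
    exact Continuous.tendsto' (by fun_prop) _ _ (by simp)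
  have hμ : Tendsto (fun μ : ℝ => μ) (nhdsWithin 0 (Set.Ioi 0)) (nhds 0) :=
    tendsto_nhdsWithin_of_tendsto_nhds tendsto_id
  have hS : Tendsto
      (fun μ : ℝ => Eᵀ * E - μ • (Eᵀ * U * (Sig + μ • (Uᵀ * U))⁻¹ * Uᵀ * E))
      (nhdsWithin 0 (Set.Ioi 0)) (nhds (Eᵀ * E)) := by
    have hcont : Continuous fun R : Matrix (Fin m) (Fin m) ℝ => Eᵀ * U * R * Uᵀ * E := by
      fun_prop
    simpa using tendsto_const_nhds.sub (hμ.smul ((hcont.tendsto _).comp hR))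
  have hdet := ((continuous_id.matrix_det.tendsto (Eᵀ * E)).comp hS).eventually_ne hE.ne_zero
  have hmul : Continuous fun p : Matrix (Fin m) (Fin m) ℝ × Matrix (Fin k) (Fin k) ℝ =>
      -(p.1 * Uᵀ * E * p.2) := by
    fun_prop
  refine ((hmul.tendsto _).comp (hR.prodMk_nhds (tendsto_matrix_inv hE hS))).congr' ?_
  filter_upwards [self_mem_nhdsWithin, hdet] with μ hpos hne
  have hμ0 : μ ≠ 0 := ne_of_gt hpos
  simp only [Function.comp_apply, id_eq] at hne ⊢
  have := invertibleOfNonzero hμ0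
  rw [pow_two, mul_smul, ← smul_sub, Matrix.inv_smul _ _ (isUnit_iff_ne_zero.2 hne), invOf_eq_inv,
    Matrix.mul_smul, smul_inv_smul₀ hμ0]
end

section
/- Let Σ be an m×m symmetric positive definite real matrix, Ū an n×m real matrix, and Ē an n×k real matrix with ĒᵀĒ invertible. Define, for sufficiently small μ > 0, M₂₂(μ) = (μ ĒᵀĒ − μ² Ēᵀ Ū (Σ + μ ŪᵀŪ)⁻¹ Ūᵀ Ē)⁻¹ and M₁₁(μ) = (Σ + μ ŪᵀŪ)⁻¹ + μ² (Σ + μ ŪᵀŪ)⁻¹ Ūᵀ Ē M₂₂(μ) Ēᵀ Ū (Σ + μ ŪᵀŪ)⁻¹. Then M₁₁(μ) converges to Σ⁻¹ as μ → 0⁺. -/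
open Matrix Filter

/-- Inversion of real square matrices is continuous along a family at a point where the determinant
is a unit. -/
theorem continuousAt_nonsing_inv {X ι : Type*} [TopologicalSpace X] [Fintype ι] [DecidableEq ι]
    {f : X → Matrix ι ι ℝ} {x : X} (hf : ContinuousAt f x) (hx : IsUnit (f x).det) :
    ContinuousAt (fun y => (f y)⁻¹) x := by
  refine ContinuousAt.comp (f := f) (g := Inv.inv) (continuousAt_matrix_inv _ ?_) hf
  obtain ⟨u, hu⟩ := hx
  rw [← hu]
  exact NormedRing.inverse_continuousAt u

/-- Over a field, inversion of matrices commutes with scaling by a nonzero scalar, even for singular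
matrices. -/
theorem nonsing_inv_smul_of_ne_zero {K ι : Type*} [Field K] [Fintype ι] [DecidableEq ι]
    {c : K} (hc : c ≠ 0) (A : Matrix ι ι K) : (c • A)⁻¹ = c⁻¹ • A⁻¹ := by
  by_cases hA : IsUnit A.det
  · simpa [Units.smul_def] using Matrix.inv_smul' A (Units.mk0 c hc) hA
  · have hcA : ¬IsUnit (c • A).det := by
      simpa [det_smul, hc] using hA
    rw [nonsing_inv_apply_not_isUnit _ hA, nonsing_inv_apply_not_isUnit _ hcA, smul_zero]

/-- The Schur-complement block
`M₁₁(μ) = (Σ + μŪᵀŪ)⁻¹ + μ² (Σ + μŪᵀŪ)⁻¹ ŪᵀĒ M₂₂(μ) ĒᵀŪ (Σ + μŪᵀŪ)⁻¹`, where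
`M₂₂(μ) = (μ ĒᵀĒ − μ² ĒᵀŪ(Σ + μŪᵀŪ)⁻¹ŪᵀĒ)⁻¹`, converges to `Σ⁻¹` as `μ → 0⁺`. -/
theorem stmt_7 {n m k : ℕ}
    (Sig : Matrix (Fin m) (Fin m) ℝ) (hSig : Sig.PosDef)
    (U : Matrix (Fin n) (Fin m) ℝ) (E : Matrix (Fin n) (Fin k) ℝ)
    (hE : IsUnit (Eᵀ * E).det) :
    Tendsto
      (fun μ : ℝ =>
        (Sig + μ • (Uᵀ * U))⁻¹
          + (μ ^ 2) • ((Sig + μ • (Uᵀ * U))⁻¹ * Uᵀ * E *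
              (μ • (Eᵀ * E)
                - (μ ^ 2) • (Eᵀ * U * (Sig + μ • (Uᵀ * U))⁻¹ * Uᵀ * E))⁻¹ *
              Eᵀ * U * (Sig + μ • (Uᵀ * U))⁻¹))
      (nhdsWithin 0 (Set.Ioi 0))
      (nhds Sig⁻¹) := by
  have hinv : ContinuousAt (fun μ : ℝ => (Sig + μ • (Uᵀ * U))⁻¹) 0 :=
    continuousAt_nonsing_inv (by fun_prop) (by simpa using hSig.det_pos.ne')
  have hschur : ContinuousAt (fun μ : ℝ =>
      (Eᵀ * E - μ • (Eᵀ * U * (Sig + μ • (Uᵀ * U))⁻¹ * Uᵀ * E))⁻¹) 0 :=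
    continuousAt_nonsing_inv (by fun_prop) (by simpa using hE)
  have hcont : ContinuousAt (fun μ : ℝ =>
      (Sig + μ • (Uᵀ * U))⁻¹
        + μ • ((Sig + μ • (Uᵀ * U))⁻¹ * Uᵀ * E *
            (Eᵀ * E - μ • (Eᵀ * U * (Sig + μ • (Uᵀ * U))⁻¹ * Uᵀ * E))⁻¹ *
            Eᵀ * U * (Sig + μ • (Uᵀ * U))⁻¹)) 0 := by
    fun_prop
  have hlim := hcont.tendsto.mono_left (nhdsWithin_le_nhds (s := Set.Ioi (0 : ℝ)))
  simp only [zero_smul, add_zero] at hlim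
  refine hlim.congr' ?_
  filter_upwards [self_mem_nhdsWithin] with μ hμ
  have hμ0 : μ ≠ 0 := (Set.mem_Ioi.mp hμ).ne'
  rw [pow_two, mul_smul μ μ (Eᵀ * U * _ * Uᵀ * E), ← smul_sub, nonsing_inv_smul_of_ne_zero hμ0]
  simp only [Matrix.mul_smul, Matrix.smul_mul, smul_smul]
  rw [mul_assoc, mul_inv_cancel₀ hμ0, mul_one]
end

section
/- Let L be an M×M symmetric positive semidefinite real matrix admitting the decomposition L = U Σ Uᵀ, where U is an M×m real matrix with orthonormal columns (UᵀU = I_m), Σ is an m×m symmetric positive definite matrix, and E₀ is an M×k real matrix with orthonormal columns (E₀ᵀE₀ = I_k) satisfying UᵀE₀ = 0 and U Uᵀ + E₀E₀ᵀ = I_M (so the columns of E₀ span the kernel of L). Let A be an M×N real matrix and set Ē = Aᵀ E₀ (an N×k matrix), and assume ĒᵀĒ is invertible. Then for all sufficiently small μ > 0 the matrix μ A Aᵀ + L is invertible, and the matrix D(μ) = μ Aᵀ (μ A Aᵀ + L)⁻¹ A converges to the orthogonal projection Ē (ĒᵀĒ)⁻¹ Ēᵀ as μ → 0⁺. -/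
open Matrix Filter

theorem Matrix.continuousAt_inv_of_isUnit_det {n : Type*} [Fintype n] [DecidableEq n]
    {S : Matrix n n ℝ} (hS : IsUnit S.det) :
    ContinuousAt (fun X : Matrix n n ℝ => X⁻¹) S := by
  have hinv : (fun X : Matrix n n ℝ => X⁻¹) = fun X => X.det⁻¹ • X.adjugate := by
    funext X
    rw [Matrix.inv_def, Ring.inverse_eq_inv']
  rw [hinv]
  exact (continuous_id.matrix_det.continuousAt.inv₀ hS.ne_zero).smul
    continuous_id.matrix_adjugate.continuousAt

/-- If `(μB + L)(P + μQ) = μ(BP + L + μBQ)` and the limit `BP + L` of the right-hand factor is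
invertible, then `μB + L` is eventually invertible and `μ(μB + L)⁻¹ → P(BP + L)⁻¹`. -/
theorem Matrix.tendsto_smul_inv_smul_add {n : Type*} [Fintype n] [DecidableEq n]
    (B L P Q : Matrix n n ℝ) (hLP : L * P = 0) (hLQ : L * Q = L)
    (hS : IsUnit (B * P + L).det) :
    (∀ᶠ μ : ℝ in nhdsWithin 0 (Set.Ioi 0), IsUnit (μ • B + L).det) ∧
    Tendsto (fun μ : ℝ => μ • (μ • B + L)⁻¹) (nhdsWithin 0 (Set.Ioi 0))
      (nhds (P * (B * P + L)⁻¹)) := by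
  have hfac (μ : ℝ) : (μ • B + L) * (P + μ • Q) = μ • (B * P + L + μ • (B * Q)) := by
    simp only [add_mul, mul_add, Matrix.smul_mul, Matrix.mul_smul, hLP, hLQ, smul_add]
    abel
  have hScont : Continuous fun μ : ℝ => B * P + L + μ • (B * Q) := by fun_prop
  have hev : ∀ᶠ μ : ℝ in nhdsWithin 0 (Set.Ioi 0),
      0 < μ ∧ IsUnit (B * P + L + μ • (B * Q)).det := by
    refine eventually_mem_nhdsWithin.and (Filter.Eventually.filter_mono nhdsWithin_le_nhds ?_)
    simp only [isUnit_iff_ne_zero]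
    refine hScont.matrix_det.continuousAt.eventually_ne ?_
    simpa using hS.ne_zero
  have hunit : ∀ᶠ μ : ℝ in nhdsWithin 0 (Set.Ioi 0), IsUnit (μ • B + L).det := by
    filter_upwards [hev] with μ ⟨hμ, hSμ⟩
    have hdet := congrArg Matrix.det (hfac μ)
    rw [det_mul, det_smul] at hdet
    refine isUnit_of_mul_isUnit_left (y := (P + μ • Q).det) ?_
    rw [hdet]
    exact ((isUnit_iff_ne_zero.2 hμ.ne').pow _).mul hSμ
  refine ⟨hunit, ?_⟩
  have hlim : Tendsto (fun μ : ℝ => (P + μ • Q) * (B * P + L + μ • (B * Q))⁻¹)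
      (nhds 0) (nhds (P * (B * P + L)⁻¹)) := by
    have hT : Tendsto (fun μ : ℝ => P + μ • Q) (nhds 0) (nhds P) := by
      have hTcont : Continuous fun μ : ℝ => P + μ • Q := by fun_prop
      simpa using hTcont.tendsto 0
    have hS₀ : Tendsto (fun μ : ℝ => B * P + L + μ • (B * Q)) (nhds 0) (nhds (B * P + L)) := by
      simpa using hScont.tendsto 0
    exact hT.mul ((continuousAt_inv_of_isUnit_det hS).tendsto.comp hS₀)
  refine (hlim.mono_left nhdsWithin_le_nhds).congr' ?_
  filter_upwards [hev, hunit] with μ ⟨_, hSμ⟩ hμ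
  calc (P + μ • Q) * (B * P + L + μ • (B * Q))⁻¹
      = (μ • B + L)⁻¹ * ((μ • B + L) * (P + μ • Q)) * (B * P + L + μ • (B * Q))⁻¹ := by
        rw [nonsing_inv_mul_cancel_left _ _ hμ]
    _ = μ • (μ • B + L)⁻¹ := by
        rw [hfac, Matrix.mul_smul, Matrix.smul_mul, mul_nonsing_inv_cancel_right _ _ hSμ]

/-- With `L = UΣUᵀ` (orthonormal `U`, positive definite `Σ`), `E₀` an orthonormal
basis of `ker L`, and `Ē = AᵀE₀` with `ĒᵀĒ` invertible: for all sufficiently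
small `μ > 0` the matrix `μAAᵀ + L` is invertible, and
`D(μ) = μ Aᵀ(μAAᵀ + L)⁻¹A → Ē(ĒᵀĒ)⁻¹Ēᵀ` as `μ → 0⁺`. -/
theorem stmt_8 {M N m k : ℕ}
    (L : Matrix (Fin M) (Fin M) ℝ) (hLpsd : L.PosSemidef)
    (U : Matrix (Fin M) (Fin m) ℝ) (Sig : Matrix (Fin m) (Fin m) ℝ)
    (E₀ : Matrix (Fin M) (Fin k) ℝ)
    (hSig : Sig.PosDef) (hL : L = U * Sig * Uᵀ)
    (hU : Uᵀ * U = 1) (hE₀ : E₀ᵀ * E₀ = 1) (hUE : Uᵀ * E₀ = 0)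
    (hcomp : U * Uᵀ + E₀ * E₀ᵀ = 1)
    (A : Matrix (Fin M) (Fin N) ℝ)
    (hE : IsUnit ((Aᵀ * E₀)ᵀ * (Aᵀ * E₀)).det) :
    (∃ μ₀ > (0 : ℝ), ∀ μ : ℝ, 0 < μ → μ < μ₀ →
      IsUnit (μ • (A * Aᵀ) + L).det) ∧
    Tendsto
      (fun μ : ℝ => μ • (Aᵀ * (μ • (A * Aᵀ) + L)⁻¹ * A))
      (nhdsWithin 0 (Set.Ioi 0))
      (nhds ((Aᵀ * E₀) * ((Aᵀ * E₀)ᵀ * (Aᵀ * E₀))⁻¹ * (Aᵀ * E₀)ᵀ)) := by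
  set G := (Aᵀ * E₀)ᵀ * (Aᵀ * E₀) with hG
  have hG' : E₀ᵀ * (A * Aᵀ) * E₀ = G := by
    simp only [hG, transpose_mul, transpose_transpose, Matrix.mul_assoc]
  have hEU : E₀ᵀ * U = 0 := by simpa using congrArg transpose hUE
  have hSigdet : IsUnit Sig.det := isUnit_iff_ne_zero.2 hSig.det_pos.ne'
  have hLP : L * (E₀ * E₀ᵀ) = 0 := by
    rw [hL, Matrix.mul_assoc, ← Matrix.mul_assoc Uᵀ, hUE, Matrix.zero_mul, Matrix.mul_zero]
  have hLQ : L * (U * Uᵀ) = L := by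
    rw [hL, Matrix.mul_assoc, ← Matrix.mul_assoc Uᵀ, hU, Matrix.one_mul]
  have hF : E₀ * G⁻¹ * E₀ᵀ * (A * Aᵀ * (E₀ * E₀ᵀ) + L) = E₀ * E₀ᵀ := by
    calc E₀ * G⁻¹ * E₀ᵀ * (A * Aᵀ * (E₀ * E₀ᵀ) + L)
        = E₀ * (G⁻¹ * (E₀ᵀ * (A * Aᵀ) * E₀)) * E₀ᵀ + E₀ * G⁻¹ * (E₀ᵀ * U) * Sig * Uᵀ := by
          simp only [hL, Matrix.mul_add, Matrix.mul_assoc]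
      _ = E₀ * E₀ᵀ := by
          rw [hG', hEU, nonsing_inv_mul _ hE]
          simp
  have hH : U * Sig⁻¹ * Uᵀ * L = U * Uᵀ := by
    calc U * Sig⁻¹ * Uᵀ * L = U * (Sig⁻¹ * ((Uᵀ * U) * Sig)) * Uᵀ := by
          simp only [hL, Matrix.mul_assoc]
      _ = U * Uᵀ := by
          rw [hU, Matrix.one_mul, nonsing_inv_mul _ hSigdet, Matrix.mul_one]
  have hS : IsUnit (A * Aᵀ * (E₀ * E₀ᵀ) + L).det := by
    refine isUnit_det_of_left_inverse (B := E₀ * G⁻¹ * E₀ᵀ + U * Sig⁻¹ * Uᵀ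
      - U * Sig⁻¹ * Uᵀ * (A * Aᵀ) * (E₀ * G⁻¹ * E₀ᵀ)) ?_
    rw [Matrix.sub_mul, Matrix.add_mul, Matrix.mul_assoc (U * Sig⁻¹ * Uᵀ * (A * Aᵀ)), hF,
      Matrix.mul_add (U * Sig⁻¹ * Uᵀ), hH, ← hcomp, Matrix.mul_assoc _ (A * Aᵀ)]
    abel
  have hPS : E₀ * E₀ᵀ * (A * Aᵀ * (E₀ * E₀ᵀ) + L)⁻¹ = E₀ * G⁻¹ * E₀ᵀ := by
    simpa only [mul_nonsing_inv_cancel_right _ _ hS] using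
      congrArg (· * (A * Aᵀ * (E₀ * E₀ᵀ) + L)⁻¹) hF.symm
  obtain ⟨hunit, hlim⟩ := tendsto_smul_inv_smul_add (A * Aᵀ) L _ _ hLP hLQ hS
  constructor
  · obtain ⟨μ₀, hμ₀, hsub⟩ := mem_nhdsGT_iff_exists_Ioo_subset.1 hunit
    exact ⟨μ₀, hμ₀, fun μ h₀ h₁ => hsub ⟨h₀, h₁⟩⟩
  · rw [hPS] at hlim
    have hcont : Continuous fun X : Matrix (Fin M) (Fin M) ℝ => Aᵀ * X * A := by fun_prop
    have hAlim := (hcont.tendsto _).comp hlim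
    have hval : Aᵀ * E₀ * G⁻¹ * (Aᵀ * E₀)ᵀ = Aᵀ * (E₀ * G⁻¹ * E₀ᵀ) * A := by
      simp only [transpose_mul, transpose_transpose, Matrix.mul_assoc]
    rw [hval]
    refine hAlim.congr fun μ => ?_
    simp only [Function.comp_apply, Matrix.mul_smul, Matrix.smul_mul]
end
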